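/- arXiv:2003.00652 — 2 statements merged into one kernel-verified Lean document; each statement's English description precedes it below -/
import Mathlib

section
/- Let Ω₁,…,Ω_n be nonempty finite subsets of ℝ^d and let Ω = Ω₁×⋯×Ω_n ⊆ ℝ^{nd} carry the Euclidean metric (each marginal space ∏_{i∈S} Ω_i likewise carries the Euclidean metric). Let diam(Ω) be the diameter of Ω and d_min the smallest distance between pairs of distinct points in Ω. Let p ≥ 1, and let P, Q be probability measures on Ω that are both Bayes-nets with respect to a common DAG G with topological ordering (1,…,n) and parent sets Π_i ⊆ {1,…,i−1}. Then W_p(P,Q) ≤ (2^{1/p}·diam(Ω)/d_min)·Σ_{i=1}^n W_p(P_{X_i∪X_{Π_i}}, Q_{X_i∪X_{Π_i}}). -/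
open MeasureTheory ProbabilityTheory Filter
open scoped ENNReal NNReal

noncomputable section

universe u

/-- Projection of a point of a product space onto the coordinates in `S`. -/
def proj {n : ℕ} {Ω : Fin n → Type*} (S : Finset (Fin n)) (x : ∀ i, Ω i) (i : S) : Ω i := x i

lemma measurable_proj {n : ℕ} {Ω : Fin n → Type*} [∀ i, MeasurableSpace (Ω i)]
    (S : Finset (Fin n)) : Measurable (proj (Ω := Ω) S) :=
  measurable_pi_lambda _ fun _ => measurable_pi_apply _

/-- A finite measure `P` on a product of standard Borel spaces is a Bayes-net with respect to
the parent structure `par` (for the topological ordering `0 < 1 < ⋯ < n-1`) if, for every `i`,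
the `i`-th coordinate is conditionally independent of the tuple of previous coordinates given
the tuple of parent coordinates `par i`. -/
def IsBayesNet {n : ℕ} {Ω : Fin n → Type*} [∀ i, MeasurableSpace (Ω i)]
    [∀ i, StandardBorelSpace (Ω i)] [∀ i, Nonempty (Ω i)]
    (P : Measure (∀ i, Ω i)) [IsFiniteMeasure P] (par : Fin n → Finset (Fin n)) : Prop :=
  ∀ i : Fin n,
    CondIndepFun (MeasurableSpace.comap (proj (par i)) inferInstance)
      ((measurable_proj (par i)).comap_le) (fun x => x i) (proj (Finset.Iio i)) P

/-- The set of couplings of `P` and `Q`: measures on the square whose first marginal is `P`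
and second marginal is `Q`. -/
def couplings {Ω : Type*} [MeasurableSpace Ω] (P Q : Measure Ω) : Set (Measure (Ω × Ω)) :=
  {γ | γ.map Prod.fst = P ∧ γ.map Prod.snd = Q}

/-- The `p`-Wasserstein distance with cost (metric) `c`:
`W_p(P,Q) = (inf_{γ ∈ Γ(P,Q)} ∫ c(x,y)^p dγ(x,y))^(1/p)`. -/
def wasserstein {Ω : Type*} [MeasurableSpace Ω] (p : ℝ) (c : Ω → Ω → ℝ)
    (P Q : Measure Ω) : ℝ≥0∞ :=
  (⨅ γ ∈ couplings P Q, ∫⁻ z, ENNReal.ofReal (c z.1 z.2 ^ p) ∂γ) ^ (1/p)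

/-- The Euclidean distance on a (finite) product of subspaces of a Euclidean space:
`d(x,y) = √(∑ᵢ d(xᵢ,yᵢ)²)`, i.e. the Euclidean metric on the concatenated vectors. -/
def eucDist {ι : Type*} [Fintype ι] {E : ι → Type*} [∀ i, PseudoMetricSpace (E i)]
    (x y : ∀ i, E i) : ℝ :=
  Real.sqrt (∑ i, dist (x i) (y i) ^ 2)

section TotalVariation

variable {α β γ : Type*}

/-- The total mass of the positive part of `μ - ν`; for probability measures on a finite discrete
space this is the total variation distance. -/
def tvDist [Fintype α] [MeasurableSpace α] (μ ν : Measure α) : ℝ≥0∞ :=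
  ∑ x, (μ {x} - ν {x})

lemma sum_measure_singleton_univ [Fintype α] [MeasurableSpace α] [MeasurableSingletonClass α]
    (μ : Measure α) : ∑ x, μ {x} = μ Set.univ := by
  simp

lemma tvDist_comm [Fintype α] [MeasurableSpace α] [MeasurableSingletonClass α]
    (μ ν : Measure α) [IsProbabilityMeasure μ] [IsProbabilityMeasure ν] :
    tvDist μ ν = tvDist ν μ := by
  have h : ∀ ρ σ : Measure α, IsProbabilityMeasure ρ →
      tvDist ρ σ + ∑ x, min (ρ {x}) (σ {x}) = 1 := by
    intro ρ σ _
    rw [tvDist, ← Finset.sum_add_distrib]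
    simp_rw [tsub_add_min]
    rw [sum_measure_singleton_univ, measure_univ]
  have h₁ := h μ ν inferInstance
  have h₂ := h ν μ inferInstance
  simp_rw [min_comm (ν _)] at h₂
  have hfin : ∑ x, min (μ {x}) (ν {x}) ≠ ⊤ := fun h => by simp [h] at h₁
  exact (ENNReal.add_left_inj hfin).1 (h₁.trans h₂.symm)

lemma measure_map_singleton_eq_sum [Fintype α] [DecidableEq β] [MeasurableSpace α]
    [MeasurableSingletonClass α] [MeasurableSpace β] [MeasurableSingletonClass β]
    (μ : Measure α) (f : α → β) (y : β) :
    μ.map f {y} = ∑ x with f x = y, μ {x} := by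
  rw [Measure.map_apply (measurable_of_finite f) (measurableSet_singleton y),
    sum_measure_singleton]
  congr 1
  ext x
  simp

lemma sum_tsub_le_sum_tsub {ι : Type*} (s : Finset ι) (f g : ι → ℝ≥0∞) :
    ∑ i ∈ s, f i - ∑ i ∈ s, g i ≤ ∑ i ∈ s, (f i - g i) := by
  rw [tsub_le_iff_right, ← Finset.sum_add_distrib]
  exact Finset.sum_le_sum fun i _ => le_tsub_add

lemma tvDist_map_le [Fintype α] [Fintype β] [MeasurableSpace α]
    [MeasurableSingletonClass α] [MeasurableSpace β] [MeasurableSingletonClass β]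
    (μ ν : Measure α) (f : α → β) : tvDist (μ.map f) (ν.map f) ≤ tvDist μ ν := by
  classical
  calc tvDist (μ.map f) (ν.map f)
      ≤ ∑ y, ∑ x with f x = y, (μ {x} - ν {x}) := by
        refine Finset.sum_le_sum fun y _ => ?_
        rw [measure_map_singleton_eq_sum, measure_map_singleton_eq_sum]
        exact sum_tsub_le_sum_tsub _ _ _
    _ = tvDist μ ν := Finset.sum_fiberwise _ _ _

lemma tvDist_eq_zero_of_subsingleton [Fintype α] [Subsingleton α] [MeasurableSpace α]
    (μ ν : Measure α) [IsProbabilityMeasure μ] [IsProbabilityMeasure ν] :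
    tvDist μ ν = 0 := by
  refine Finset.sum_eq_zero fun x _ => ?_
  rw [Set.eq_univ_of_forall (s := {x}) fun y => Subsingleton.elim y x]
  simp

lemma tvDist_le_measure_ne [Fintype α] [MeasurableSpace α] [MeasurableSingletonClass α]
    {μ ν : Measure α} {π : Measure (α × α)} (hπ : π ∈ couplings μ ν) :
    tvDist μ ν ≤ π {z | z.1 ≠ z.2} := by
  have hms (s : Set (α × α)) : MeasurableSet s := s.toFinite.measurableSet
  obtain ⟨rfl, rfl⟩ := hπ
  calc tvDist (π.map Prod.fst) (π.map Prod.snd)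
      ≤ ∑ x, π {z | z.1 ≠ z.2 ∧ z.1 = x} := by
        refine Finset.sum_le_sum fun x _ => ?_
        rw [Measure.map_apply measurable_fst (measurableSet_singleton x),
          Measure.map_apply measurable_snd (measurableSet_singleton x), tsub_le_iff_left]
        refine (measure_mono ?_).trans (measure_union_le _ _)
        rintro ⟨a, b⟩ rfl
        by_cases h : a = b
        · exact Or.inl h.symm
        · exact Or.inr ⟨h, rfl⟩
    _ = π {z | z.1 ≠ z.2} := by
        rw [← measure_biUnion_finset]
        · congr 1
          ext z
          simp
        · intro x _ y _ hxy
          refine Set.disjoint_left.2 ?_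
          rintro z ⟨-, rfl⟩ ⟨-, h⟩
          exact hxy h
        · exact fun x _ => hms _

/-- Existence of a maximal coupling. -/
lemma exists_coupling_measure_ne_le [Fintype α] [MeasurableSpace α] [MeasurableSingletonClass α]
    (μ ν : Measure α) [IsProbabilityMeasure μ] [IsProbabilityMeasure ν] :
    ∃ π ∈ couplings μ ν, π {z | z.1 ≠ z.2} ≤ tvDist μ ν := by
  have hms (s : Set (α × α)) : MeasurableSet s := s.toFinite.measurableSet
  set δ := tvDist μ ν
  let c : (α → ℝ≥0∞) → Measure α := fun w => Measure.sum fun x => w x • Measure.dirac x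
  have hc (w : α → ℝ≥0∞) (x : α) : c w {x} = w x := Measure.sum_smul_dirac_singleton
  have hcu (w : α → ℝ≥0∞) : c w Set.univ = ∑ x, w x := by
    simp [← sum_measure_singleton_univ, hc]
  let m := c fun x => min (μ {x}) (ν {x})
  let a := c fun x => μ {x} - ν {x}
  let b := c fun x => ν {x} - μ {x}
  have ha : a Set.univ = δ := hcu _
  have hb : b Set.univ = δ := (hcu _).trans (tvDist_comm ν μ)
  have ham : m + a = μ := Measure.ext_of_singleton fun x => by
    rw [Measure.add_apply, hc, hc, add_comm, tsub_add_min]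
  have hbm : m + b = ν := Measure.ext_of_singleton fun x => by
    rw [Measure.add_apply, hc, hc, add_comm, min_comm, tsub_add_min]
  have hδfin : δ ≠ ⊤ := by
    rw [← ha]
    refine ne_top_of_le_ne_top (measure_ne_top μ Set.univ) ?_
    rw [← ham, Measure.add_apply]
    exact le_add_self
  have : IsFiniteMeasure a := ⟨by rw [ha]; exact hδfin.lt_top⟩
  have : IsFiniteMeasure b := ⟨by rw [hb]; exact hδfin.lt_top⟩
  have hscale (ρ : Measure α) (hρ : ρ Set.univ = δ) : δ⁻¹ • δ • ρ = ρ := by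
    rcases eq_or_ne δ 0 with h | h
    · rw [h, Measure.measure_univ_eq_zero] at hρ
      simp [hρ]
    · rw [smul_smul, ENNReal.inv_mul_cancel h hδfin, one_smul]
  have hd : Measurable fun x : α => (x, x) := measurable_id.prodMk measurable_id
  refine ⟨m.map (fun x => (x, x)) + δ⁻¹ • a.prod b, ⟨?_, ?_⟩, ?_⟩
  · rw [Measure.map_add _ _ measurable_fst, Measure.map_map measurable_fst hd, Measure.map_smul,
      Measure.map_fst_prod, hb, hscale a ha]
    convert! ham
    exact Measure.map_id
  · rw [Measure.map_add _ _ measurable_snd, Measure.map_map measurable_snd hd, Measure.map_smul,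
      Measure.map_snd_prod, ha, hscale b hb]
    convert! hbm
    exact Measure.map_id
  · rw [Measure.add_apply, Measure.map_apply hd (hms _)]
    have h0 : (fun x : α => (x, x)) ⁻¹' {z | z.1 ≠ z.2} = ∅ := by ext; simp
    rw [h0, measure_empty, zero_add]
    calc (δ⁻¹ • a.prod b) {z | z.1 ≠ z.2} ≤ (δ⁻¹ • a.prod b) Set.univ :=
          measure_mono (Set.subset_univ _)
      _ = δ⁻¹ * (δ * δ) := by
          rw [Measure.smul_apply, smul_eq_mul, ← Set.univ_prod_univ, Measure.prod_prod, ha, hb]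
      _ ≤ δ := by
          rw [← mul_assoc]
          exact mul_le_of_le_one_left' (ENNReal.inv_mul_le_one δ)

lemma sum_measure_prod_singleton [Fintype α] [Fintype β] [MeasurableSpace α]
    [MeasurableSingletonClass α] [MeasurableSpace β] [MeasurableSingletonClass β]
    (μ : Measure (α × β)) (x : α) : ∑ y, μ {(x, y)} = μ.map Prod.fst {x} := by
  classical
  rw [measure_map_singleton_eq_sum, Finset.sum_filter, Fintype.sum_prod_type,
    Finset.sum_eq_single x] <;> simp +contextual

/-- If the second coordinate is conditionally independent of the first given a function `g` of
the first, under both `μ` and `ν`, then the total variation distance is controlled by that of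
the first marginals and that of the laws of `(g X, Y)`. -/
lemma tvDist_le_of_condIndep [Fintype α] [Fintype β] [Fintype γ]
    [MeasurableSpace α] [MeasurableSingletonClass α] [MeasurableSpace β]
    [MeasurableSingletonClass β] [MeasurableSpace γ] [MeasurableSingletonClass γ]
    (μ ν : Measure (α × β)) [IsProbabilityMeasure μ] [IsProbabilityMeasure ν] (g : α → γ)
    (hμ : ∀ x y, μ {(x, y)} * μ.map (fun z => g z.1) {g x} =
      μ.map Prod.fst {x} * μ.map (fun z => (g z.1, z.2)) {(g x, y)})
    (hν : ∀ x y, ν {(x, y)} * ν.map (fun z => g z.1) {g x} =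
      ν.map Prod.fst {x} * ν.map (fun z => (g z.1, z.2)) {(g x, y)}) :
    tvDist μ ν ≤ tvDist (μ.map Prod.fst) (ν.map Prod.fst) +
      2 * tvDist (μ.map (fun z => (g z.1, z.2))) (ν.map (fun z => (g z.1, z.2))) := by
  classical
  let K (ρ : Measure (α × β)) (c : γ) (y : β) : ℝ≥0∞ :=
    ρ.map (fun z => (g z.1, z.2)) {(c, y)} / ρ.map (fun z => g z.1) {c}
  have hfst (ρ : Measure (α × β)) :
      (ρ.map (fun z => (g z.1, z.2))).map Prod.fst = ρ.map (fun z => g z.1) :=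
    Measure.map_map measurable_fst (measurable_of_finite _)
  have hg (ρ : Measure (α × β)) : (ρ.map Prod.fst).map g = ρ.map (fun z => g z.1) :=
    Measure.map_map (measurable_of_finite _) measurable_fst
  have hKsum (ρ : Measure (α × β)) (c : γ) : ∑ y, K ρ c y ≤ 1 := by
    simp only [K, div_eq_mul_inv, ← Finset.sum_mul]
    rw [sum_measure_prod_singleton, hfst]
    exact ENNReal.mul_inv_le_one _
  have hKmul (ρ : Measure (α × β)) [IsProbabilityMeasure ρ] (c : γ) (y : β) :
      ρ.map (fun z => g z.1) {c} * K ρ c y = ρ.map (fun z => (g z.1, z.2)) {(c, y)} := by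
    have : IsProbabilityMeasure (ρ.map (fun z => (g z.1, z.2))) :=
      Measure.isProbabilityMeasure_map (measurable_of_finite _).aemeasurable
    have hle : ρ.map (fun z => (g z.1, z.2)) {(c, y)} ≤ ρ.map (fun z => g z.1) {c} := by
      rw [← hfst, ← sum_measure_prod_singleton]
      exact Finset.single_le_sum (f := fun y => ρ.map (fun z => (g z.1, z.2)) {(c, y)})
        (fun _ _ => zero_le) (Finset.mem_univ y)
    refine ENNReal.mul_div_cancel' (fun h => ?_) (fun h => ?_)
    · exact le_antisymm (hle.trans h.le) zero_le
    · rw [← hfst] at h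
      have : IsProbabilityMeasure ((ρ.map (fun z => (g z.1, z.2))).map Prod.fst) :=
        Measure.isProbabilityMeasure_map measurable_fst.aemeasurable
      exact absurd h (measure_ne_top _ _)
  have hmar (ρ : Measure (α × β)) [IsProbabilityMeasure ρ] (x : α) :
      ρ.map Prod.fst {x} ≤ ρ.map (fun z => g z.1) {g x} := by
    rw [← hg, Measure.map_apply (measurable_of_finite g) (measurableSet_singleton _)]
    exact measure_mono (by rintro _ rfl; rfl)
  have hfac (ρ : Measure (α × β)) [IsProbabilityMeasure ρ]
      (h : ∀ x y, ρ {(x, y)} * ρ.map (fun z => g z.1) {g x} =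
        ρ.map Prod.fst {x} * ρ.map (fun z => (g z.1, z.2)) {(g x, y)}) (x : α) (y : β) :
      ρ {(x, y)} = ρ.map Prod.fst {x} * K ρ (g x) y := by
    have : IsProbabilityMeasure (ρ.map (fun z => g z.1)) :=
      Measure.isProbabilityMeasure_map (measurable_of_finite _).aemeasurable
    rcases eq_or_ne (ρ.map (fun z => g z.1) {g x}) 0 with h0 | h0
    · have h1 : ρ.map Prod.fst {x} = 0 := le_antisymm ((hmar ρ x).trans h0.le) zero_le
      rw [h1, zero_mul]
      rw [← sum_measure_prod_singleton] at h1
      exact (Finset.sum_eq_zero_iff.1 h1) y (Finset.mem_univ y)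
    · simp only [K]
      rw [← mul_div_assoc, ← h, ENNReal.mul_div_cancel_right h0 (measure_ne_top _ _)]
  have : IsProbabilityMeasure (μ.map (fun z => (g z.1, z.2))) :=
    Measure.isProbabilityMeasure_map (measurable_of_finite _).aemeasurable
  have : IsProbabilityMeasure (ν.map (fun z => (g z.1, z.2))) :=
    Measure.isProbabilityMeasure_map (measurable_of_finite _).aemeasurable
  have hybrid (a b c d : ℝ≥0∞) : a * c - b * d ≤ (a - b) * c + b * (c - d) := by
    rw [tsub_le_iff_right, add_assoc, ← mul_add]
    calc a * c ≤ ((a - b) + b) * c := by gcongr; exact le_tsub_add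
      _ = (a - b) * c + b * c := add_mul _ _ _
      _ ≤ _ := by gcongr; exact le_tsub_add
  have hmid (c : γ) (y : β) : ν.map (fun z => g z.1) {c} * (K μ c y - K ν c y) ≤
      (ν.map (fun z => g z.1) {c} - μ.map (fun z => g z.1) {c}) * K μ c y +
        (μ.map (fun z => (g z.1, z.2)) {(c, y)} - ν.map (fun z => (g z.1, z.2)) {(c, y)}) := by
    have : IsProbabilityMeasure (ν.map (fun z => g z.1)) :=
      Measure.isProbabilityMeasure_map (measurable_of_finite _).aemeasurable
    rw [ENNReal.mul_sub fun _ _ => measure_ne_top _ _, hKmul ν, ← hKmul μ, tsub_le_iff_right,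
      add_assoc]
    calc _ ≤ ((ν.map (fun z => g z.1) {c} - μ.map (fun z => g z.1) {c}) +
          μ.map (fun z => g z.1) {c}) * K μ c y := by gcongr; exact le_tsub_add
      _ = _ := add_mul _ _ _
      _ ≤ _ := by gcongr; exact le_tsub_add
  calc tvDist μ ν
      ≤ ∑ x, ∑ y, ((μ.map Prod.fst {x} - ν.map Prod.fst {x}) * K μ (g x) y +
          ν.map Prod.fst {x} * (K μ (g x) y - K ν (g x) y)) := by
        rw [tvDist, Fintype.sum_prod_type]
        refine Finset.sum_le_sum fun x _ => Finset.sum_le_sum fun y _ => ?_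
        rw [hfac μ hμ, hfac ν hν]
        exact hybrid _ _ _ _
    _ = ∑ x, (μ.map Prod.fst {x} - ν.map Prod.fst {x}) * ∑ y, K μ (g x) y +
          ∑ c, ∑ y, ν.map (fun z => g z.1) {c} * (K μ c y - K ν c y) := by
        simp_rw [Finset.sum_add_distrib, Finset.mul_sum]
        congr 1
        rw [← Finset.sum_fiberwise Finset.univ g]
        refine Finset.sum_congr rfl fun c _ => ?_
        rw [Finset.sum_comm]
        refine Finset.sum_congr rfl fun y _ => ?_
        rw [← hg, measure_map_singleton_eq_sum, Finset.sum_mul]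
        refine Finset.sum_congr rfl fun x hx => ?_
        rw [(Finset.mem_filter.1 hx).2]
    _ ≤ tvDist (μ.map Prod.fst) (ν.map Prod.fst) +
          (tvDist (ν.map (fun z => g z.1)) (μ.map (fun z => g z.1)) +
            tvDist (μ.map (fun z => (g z.1, z.2))) (ν.map (fun z => (g z.1, z.2)))) := by
        refine add_le_add
          (Finset.sum_le_sum fun x _ => mul_le_of_le_one_right' (hKsum μ _)) ?_
        refine (Finset.sum_le_sum fun c _ => Finset.sum_le_sum fun y _ => hmid c y).trans ?_
        simp_rw [Finset.sum_add_distrib, ← Finset.mul_sum]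
        refine add_le_add
          (Finset.sum_le_sum fun c _ => mul_le_of_le_one_right' (hKsum μ _)) ?_
        rw [tvDist, Fintype.sum_prod_type]
    _ ≤ _ := by
        rw [two_mul]
        gcongr
        rw [← hfst, ← hfst, tvDist_comm (μ.map (fun z => (g z.1, z.2)))]
        exact tvDist_map_le _ _ _

end TotalVariation

section ConditionalIndependence

variable {Ω α β γ : Type*} [MeasurableSpace Ω] [MeasurableSpace α] [MeasurableSingletonClass α]
  [MeasurableSpace β] [MeasurableSingletonClass β] [MeasurableSpace γ] [MeasurableSingletonClass γ]

lemma condExp_indicator_mul_measureReal (P : Measure Ω) [IsFiniteMeasure P] {Z : Ω → γ}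
    (hZ : Measurable Z) {A : Set Ω} (hA : MeasurableSet A) (ω : Ω) :
    (P⟦A | MeasurableSpace.comap Z inferInstance⟧) ω * P.real (Z ⁻¹' {Z ω}) =
      P.real (A ∩ Z ⁻¹' {Z ω}) := by
  have hC : MeasurableSet[MeasurableSpace.comap Z inferInstance] (Z ⁻¹' {Z ω}) :=
    ⟨{Z ω}, measurableSet_singleton _, rfl⟩
  have hint : Integrable (A.indicator fun _ => (1 : ℝ)) P :=
    (integrable_const 1).indicator hA
  have hset := setIntegral_condExp hZ.comap_le hint hC
  have hconst : ∀ ω' ∈ Z ⁻¹' {Z ω}, (P⟦A | MeasurableSpace.comap Z inferInstance⟧) ω' =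
      (P⟦A | MeasurableSpace.comap Z inferInstance⟧) ω := fun ω' h =>
    (stronglyMeasurable_condExp.measurable : Measurable[MeasurableSpace.comap Z inferInstance]
      (P⟦A | MeasurableSpace.comap Z inferInstance⟧)).factorsThrough h
  rw [setIntegral_congr_fun (hZ (measurableSet_singleton _)) hconst, setIntegral_const,
    setIntegral_indicator hA, setIntegral_const, Set.inter_comm] at hset
  simpa [mul_comm] using hset

lemma measure_inter_mul_measure_of_condIndepFun [StandardBorelSpace Ω] {P : Measure Ω}
    [IsFiniteMeasure P] {X : Ω → β} {Y : Ω → α} {Z : Ω → γ} (hX : Measurable X)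
    (hY : Measurable Y) (hZ : Measurable Z)
    (h : CondIndepFun (MeasurableSpace.comap Z inferInstance) hZ.comap_le X Y P)
    {g : α → γ} (hg : ∀ ω, g (Y ω) = Z ω) (y : α) (x : β) :
    P (X ⁻¹' {x} ∩ Y ⁻¹' {y}) * P (Z ⁻¹' {g y}) =
      P (Y ⁻¹' {y}) * P (X ⁻¹' {x} ∩ Z ⁻¹' {g y}) := by
  have hA := hX (measurableSet_singleton x)
  have hB := hY (measurableSet_singleton y)
  have hBC : Y ⁻¹' {y} ⊆ Z ⁻¹' {g y} := by
    rintro ω rfl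
    exact (hg ω).symm
  rcases eq_or_ne (P (Z ⁻¹' {g y})) 0 with h0 | h0
  · rw [h0, measure_mono_null hBC h0, mul_zero, zero_mul]
  have hae := (condIndepFun_iff_condExp_inter_preimage_eq_mul hX hY).1 h {x} {y}
    (measurableSet_singleton x) (measurableSet_singleton y)
  obtain ⟨ω, hωC, hω⟩ := ((frequently_ae_mem_iff.2 h0).and_eventually hae).exists
  have hωC' : Z ω = g y := hωC
  have eAB := condExp_indicator_mul_measureReal P hZ (hA.inter hB) ω
  have eA := condExp_indicator_mul_measureReal P hZ hA ω
  have eB := condExp_indicator_mul_measureReal P hZ hB ω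
  rw [hωC'] at eAB eA eB
  rw [hω] at eAB
  rw [Set.inter_assoc, Set.inter_eq_left.2 hBC] at eAB
  rw [Set.inter_eq_left.2 hBC] at eB
  rw [← ENNReal.toReal_eq_toReal_iff' (by finiteness) (by finiteness), ENNReal.toReal_mul,
    ENNReal.toReal_mul]
  change P.real _ * P.real _ = P.real _ * P.real _
  rw [← eAB, ← eA, ← eB]
  ring

lemma tvDist_map_prod_le_of_condIndepFun [StandardBorelSpace Ω] [Fintype α] [Fintype β]
    [Fintype γ] {P Q : Measure Ω} [IsProbabilityMeasure P] [IsProbabilityMeasure Q]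
    {X : Ω → β} {Y : Ω → α} {Z : Ω → γ} (hX : Measurable X)
    (hY : Measurable Y) (hZ : Measurable Z)
    (hP : CondIndepFun (MeasurableSpace.comap Z inferInstance) hZ.comap_le X Y P)
    (hQ : CondIndepFun (MeasurableSpace.comap Z inferInstance) hZ.comap_le X Y Q)
    {g : α → γ} (hg : ∀ ω, g (Y ω) = Z ω) :
    tvDist (P.map fun ω => (Y ω, X ω)) (Q.map fun ω => (Y ω, X ω)) ≤
      tvDist (P.map Y) (Q.map Y) +
        2 * tvDist (P.map fun ω => (Z ω, X ω)) (Q.map fun ω => (Z ω, X ω)) := by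
  have hYX : Measurable fun ω => (Y ω, X ω) := hY.prodMk hX
  have hfst (R : Measure Ω) : (R.map fun ω => (Y ω, X ω)).map Prod.fst = R.map Y :=
    Measure.map_map measurable_fst hYX
  have hZX (R : Measure Ω) : (R.map fun ω => (Y ω, X ω)).map (fun z => (g z.1, z.2)) =
      R.map fun ω => (Z ω, X ω) := by
    rw [Measure.map_map (measurable_of_finite _) hYX]
    simp only [Function.comp_def, hg]
  have hZ' (R : Measure Ω) : (R.map fun ω => (Y ω, X ω)).map (fun z => g z.1) = R.map Z := by
    rw [Measure.map_map (measurable_of_finite _) hYX]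
    simp only [Function.comp_def, hg]
  have key (R : Measure Ω) [IsProbabilityMeasure R]
      (hR : CondIndepFun (MeasurableSpace.comap Z inferInstance) hZ.comap_le X Y R)
      (y : α) (x : β) :
      (R.map fun ω => (Y ω, X ω)) {(y, x)} *
          (R.map fun ω => (Y ω, X ω)).map (fun z => g z.1) {g y} =
        (R.map fun ω => (Y ω, X ω)).map Prod.fst {y} *
          (R.map fun ω => (Y ω, X ω)).map (fun z => (g z.1, z.2)) {(g y, x)} := by
    rw [hfst, hZX, hZ', Measure.map_apply hYX (measurableSet_singleton _),
      Measure.map_apply hZ (measurableSet_singleton _),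
      Measure.map_apply hY (measurableSet_singleton _),
      Measure.map_apply (hZ.prodMk hX) (measurableSet_singleton _)]
    convert! measure_inter_mul_measure_of_condIndepFun hX hY hZ hR hg y x using 3 <;>
    · ext ω
      simp [and_comm]
  have : IsProbabilityMeasure (P.map fun ω => (Y ω, X ω)) :=
    Measure.isProbabilityMeasure_map hYX.aemeasurable
  have : IsProbabilityMeasure (Q.map fun ω => (Y ω, X ω)) :=
    Measure.isProbabilityMeasure_map hYX.aemeasurable
  have := tvDist_le_of_condIndep _ _ g (key P hP) (key Q hQ)
  rwa [hfst, hfst, hZX, hZX] at this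

end ConditionalIndependence

section BayesNet

variable {n : ℕ} {Ω : Fin n → Type*}

/-- Reassembling a tuple indexed by `S` and a value at `i` into a tuple indexed by
`insert i S`. -/
def insertTuple {S : Finset (Fin n)} {i : Fin n} (z : (∀ j : S, Ω j) × Ω i)
    (j : (insert i S : Finset (Fin n))) : Ω j :=
  if h : (j : Fin n) = i then cast (congrArg Ω h.symm) z.2
  else z.1 ⟨j, (Finset.mem_insert.1 j.2).resolve_left h⟩

lemma insertTuple_proj (S : Finset (Fin n)) (i : Fin n) (x : ∀ j, Ω j) :
    insertTuple (S := S) (proj S x, x i) = proj (insert i S) x := by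
  funext ⟨j, hj⟩
  by_cases h : j = i
  · subst h
    simp [insertTuple, proj]
  · simp [insertTuple, proj, h]

variable [∀ i, MeasurableSpace (Ω i)]
  [∀ i, StandardBorelSpace (Ω i)] [∀ i, Nonempty (Ω i)] [∀ i, Fintype (Ω i)]

lemma IsBayesNet.tvDist_proj_insert_le {P Q : Measure (∀ i, Ω i)} [IsProbabilityMeasure P]
    [IsProbabilityMeasure Q] {par : Fin n → Finset (Fin n)} (hP : IsBayesNet P par)
    (hQ : IsBayesNet Q par) (i : Fin n) (hpar : par i ⊆ Finset.Iio i) :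
    tvDist (P.map (proj (insert i (Finset.Iio i)))) (Q.map (proj (insert i (Finset.Iio i)))) ≤
      tvDist (P.map (proj (Finset.Iio i))) (Q.map (proj (Finset.Iio i))) +
        2 * tvDist (P.map (proj (insert i (par i)))) (Q.map (proj (insert i (par i)))) := by
  have hX : Measurable fun x : ∀ j, Ω j => x i := measurable_pi_apply i
  have key := tvDist_map_prod_le_of_condIndepFun hX (measurable_proj (Finset.Iio i))
    (measurable_proj (par i)) (hP i) (hQ i) (g := fun y j => y ⟨j, hpar j.2⟩) fun _ => rfl
  refine le_trans ?_ (key.trans ?_)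
  · have h (R : Measure (∀ i, Ω i)) : R.map (proj (insert i (Finset.Iio i))) =
        (R.map fun x => (proj (Finset.Iio i) x, x i)).map insertTuple := by
      rw [Measure.map_map (measurable_of_finite _) ((measurable_proj _).prodMk hX)]
      simp only [Function.comp_def, insertTuple_proj]
    rw [h, h]
    exact tvDist_map_le _ _ _
  · have h (R : Measure (∀ i, Ω i)) : (R.map fun x => (proj (par i) x, x i)) =
        (R.map (proj (insert i (par i)))).map fun y =>
          (fun j : par i => y ⟨j, Finset.mem_insert_of_mem j.2⟩,
            y ⟨i, Finset.mem_insert_self i _⟩) := by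
      rw [Measure.map_map (measurable_of_finite _) (measurable_proj _)]
      rfl
    rw [h, h]
    gcongr
    exact tvDist_map_le _ _ _

lemma IsBayesNet.tvDist_le {P Q : Measure (∀ i, Ω i)} [IsProbabilityMeasure P]
    [IsProbabilityMeasure Q] {par : Fin n → Finset (Fin n)} (hP : IsBayesNet P par)
    (hQ : IsBayesNet Q par) (hpar : ∀ i, par i ⊆ Finset.Iio i) :
    tvDist P Q ≤ 2 * ∑ i,
      tvDist (P.map (proj (insert i (par i)))) (Q.map (proj (insert i (par i)))) := by
  have hinit : ∀ k ≤ n, tvDist (P.map (proj {j : Fin n | j.val < k}))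
      (Q.map (proj {j : Fin n | j.val < k})) ≤ 2 * ∑ i with i.val < k,
        tvDist (P.map (proj (insert i (par i)))) (Q.map (proj (insert i (par i)))) := by
    intro k hk
    induction k with
    | zero =>
      have : IsEmpty (({j : Fin n | j.val < 0} : Finset (Fin n))) := ⟨fun j => by simpa using j.2⟩
      have hP' : IsProbabilityMeasure (P.map (proj ({j : Fin n | j.val < 0} : Finset (Fin n)))) :=
        Measure.isProbabilityMeasure_map (measurable_proj _).aemeasurable
      have hQ' : IsProbabilityMeasure (Q.map (proj ({j : Fin n | j.val < 0} : Finset (Fin n)))) :=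
        Measure.isProbabilityMeasure_map (measurable_proj _).aemeasurable
      rw [tvDist_eq_zero_of_subsingleton]
      exact zero_le
    | succ k ih =>
      let i : Fin n := ⟨k, hk⟩
      have hIio : ({j : Fin n | j.val < k} : Finset (Fin n)) = Finset.Iio i := by
        ext j
        simp [i, Fin.lt_def]
      have hIic : ({j : Fin n | j.val < k + 1} : Finset (Fin n)) =
          insert i (Finset.Iio i) := by
        ext j
        simp [i, Fin.le_def]
      have ih' := ih (Nat.le_of_succ_le hk)
      rw [hIio] at ih'
      rw [hIic, Finset.sum_insert (by simp), mul_add, add_comm]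
      exact (hP.tvDist_proj_insert_le hQ i (hpar i)).trans (by gcongr)
  have huniv (R : Measure (∀ i, Ω i)) :
      R = (R.map (proj ({j : Fin n | j.val < n} : Finset (Fin n)))).map
        fun y j => y ⟨j, by simp⟩ := by
    rw [Measure.map_map (measurable_of_finite _) (measurable_proj _)]
    exact Measure.map_id.symm
  calc tvDist P Q ≤ _ := by
        conv_lhs => rw [huniv P, huniv Q]
        exact tvDist_map_le _ _ _
    _ ≤ _ := hinit n le_rfl
    _ ≤ _ := by
        gcongr
        exact Finset.subset_univ _

end BayesNet

section Wasserstein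

variable {α : Type*} [Fintype α] [MeasurableSpace α] [MeasurableSingletonClass α]

lemma wasserstein_le_mul_tvDist_rpow {p : ℝ} (hp : 0 < p) {c : α → α → ℝ}
    (hc : ∀ x, c x x = 0) (hc0 : ∀ x y, 0 ≤ c x y) {D : ℝ} (hD : ∀ x y, c x y ≤ D)
    (μ ν : Measure α) [IsProbabilityMeasure μ] [IsProbabilityMeasure ν] :
    wasserstein p c μ ν ≤ ENNReal.ofReal D * tvDist μ ν ^ (1 / p) := by
  have hms (s : Set (α × α)) : MeasurableSet s := s.toFinite.measurableSet
  obtain ⟨π, hπ, hle⟩ := exists_coupling_measure_ne_le μ ν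
  have hcost : ∫⁻ z, ENNReal.ofReal (c z.1 z.2 ^ p) ∂π ≤ ENNReal.ofReal D ^ p * tvDist μ ν :=
    calc ∫⁻ z, ENNReal.ofReal (c z.1 z.2 ^ p) ∂π
        ≤ ∫⁻ z, {z : α × α | z.1 ≠ z.2}.indicator (fun _ => ENNReal.ofReal D ^ p) z ∂π := by
          refine lintegral_mono fun z => ?_
          by_cases h : z.1 = z.2
          · simp [h, hc, Real.zero_rpow hp.ne']
          · rw [Set.indicator_of_mem (by exact h),
              ← ENNReal.ofReal_rpow_of_nonneg (hc0 _ _) hp.le]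
            gcongr
            exact hD _ _
      _ = ENNReal.ofReal D ^ p * π {z | z.1 ≠ z.2} := lintegral_indicator_const (hms _) _
      _ ≤ _ := by gcongr
  calc wasserstein p c μ ν ≤ (ENNReal.ofReal D ^ p * tvDist μ ν) ^ (1 / p) := by
        unfold wasserstein
        gcongr
        exact (iInf₂_le π hπ).trans hcost
    _ = _ := by
        rw [ENNReal.mul_rpow_of_nonneg _ _ (by positivity), ← ENNReal.rpow_mul,
          mul_one_div_cancel hp.ne', ENNReal.rpow_one]

lemma mul_tvDist_rpow_le_wasserstein {p : ℝ} (hp : 0 < p) {c : α → α → ℝ}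
    {m : ℝ} (hm : 0 ≤ m) (hmc : ∀ x y, x ≠ y → m ≤ c x y) (μ ν : Measure α) :
    ENNReal.ofReal m * tvDist μ ν ^ (1 / p) ≤ wasserstein p c μ ν := by
  have hms (s : Set (α × α)) : MeasurableSet s := s.toFinite.measurableSet
  calc ENNReal.ofReal m * tvDist μ ν ^ (1 / p)
      = (ENNReal.ofReal m ^ p * tvDist μ ν) ^ (1 / p) := by
        rw [ENNReal.mul_rpow_of_nonneg _ _ (by positivity), ← ENNReal.rpow_mul,
          mul_one_div_cancel hp.ne', ENNReal.rpow_one]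
    _ ≤ wasserstein p c μ ν := by
        unfold wasserstein
        gcongr
        refine le_iInf₂ fun π hπ => ?_
        calc ENNReal.ofReal m ^ p * tvDist μ ν
            ≤ ENNReal.ofReal m ^ p * π {z | z.1 ≠ z.2} := by
              gcongr
              exact tvDist_le_measure_ne hπ
          _ = ∫⁻ z, {z : α × α | z.1 ≠ z.2}.indicator (fun _ => ENNReal.ofReal m ^ p) z ∂π :=
              (lintegral_indicator_const (hms _) _).symm
          _ ≤ _ := by
              refine lintegral_mono fun z => ?_
              by_cases h : z.1 = z.2
              · simp [h]
              · rw [Set.indicator_of_mem (by exact h), ENNReal.ofReal_rpow_of_nonneg hm hp.le]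
                gcongr
                exact hmc _ _ h

end Wasserstein

lemma ENNReal.sum_rpow_le_sum_rpow_of_le_one {ι : Type*} (s : Finset ι) (f : ι → ℝ≥0∞) {q : ℝ}
    (hq : 0 < q) (hq1 : q ≤ 1) : (∑ i ∈ s, f i) ^ q ≤ ∑ i ∈ s, f i ^ q := by
  classical
  induction s using Finset.induction_on with
  | empty => simp [hq]
  | insert a s ha ih =>
    rw [Finset.sum_insert ha, Finset.sum_insert ha]
    exact (ENNReal.rpow_add_le_add_rpow _ _ hq.le hq1).trans (by gcongr)

lemma eucDist_self {ι : Type*} [Fintype ι] {E : ι → Type*} [∀ i, PseudoMetricSpace (E i)]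
    (x : ∀ i, E i) : eucDist x x = 0 := by
  simp [eucDist]

lemma eucDist_pos {ι : Type*} [Fintype ι] {E : ι → Type*} [∀ i, MetricSpace (E i)]
    {x y : ∀ i, E i} (h : x ≠ y) : 0 < eucDist x y := by
  obtain ⟨i, hi⟩ := Function.ne_iff.1 h
  refine Real.sqrt_pos.2 (Finset.sum_pos' (fun _ _ => by positivity) ⟨i, Finset.mem_univ i, ?_⟩)
  have := dist_pos.2 hi
  positivity

/-- Every pair of distinct points of a marginal space lifts to a pair of distinct points of the
product space at the same Euclidean distance. -/
lemma exists_eucDist_eq_of_ne {n : ℕ} {E : Fin n → Type*} [∀ i, PseudoMetricSpace (E i)]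
    [∀ i, Nonempty (E i)] (S : Finset (Fin n)) {s t : ∀ i : S, E i} (hst : s ≠ t) :
    ∃ x y : ∀ i, E i, x ≠ y ∧ eucDist s t = eucDist x y := by
  let w : ∀ i, E i := fun _ => Classical.arbitrary _
  let l (s : ∀ i : S, E i) (i : Fin n) : E i := if h : i ∈ S then s ⟨i, h⟩ else w i
  have hl (s : ∀ i : S, E i) (i : S) : l s i = s i := by simp [l]
  refine ⟨l s, l t, fun h => hst (funext fun i => ?_), ?_⟩
  · rw [← hl s, ← hl t, h]
  · unfold eucDist
    congr 1
    rw [← Finset.sum_subset (Finset.subset_univ S)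
      (fun i _ hi => by simp [l, hi]), ← Finset.sum_coe_sort S]
    exact Finset.sum_congr rfl fun i _ => by rw [hl, hl]

/-- `(2^(1/p) · diam(Ω) / d_min)`-linear subadditivity of the `p`-Wasserstein distance
(w.r.t. the Euclidean metric) on Bayes-nets over products of nonempty finite subsets of
`ℝ^d`.  Here `diam(Ω)` is the (Euclidean) diameter of the product space and `d_min` is the
smallest Euclidean distance between pairs of distinct points of the product space. -/
theorem wasserstein_linear_subadditivity_bayes_net
    {d n : ℕ} (Ω : Fin n → Finset (EuclideanSpace ℝ (Fin d))) [∀ i, Nonempty ↥(Ω i)]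
    [∀ i, StandardBorelSpace ↥(Ω i)]
    (par : Fin n → Finset (Fin n)) (hpar : ∀ i, par i ⊆ Finset.Iio i)
    (p : ℝ) (hp : 1 ≤ p)
    (P Q : Measure (∀ i, ↥(Ω i))) [IsProbabilityMeasure P] [IsProbabilityMeasure Q]
    (hP : IsBayesNet P par) (hQ : IsBayesNet Q par) :
    wasserstein p eucDist P Q ≤
      ENNReal.ofReal ((2:ℝ) ^ (1/p)
          * sSup {r : ℝ | ∃ x y : ∀ i, ↥(Ω i), r = eucDist x y}
          / sInf {r : ℝ | ∃ x y : ∀ i, ↥(Ω i), x ≠ y ∧ r = eucDist x y})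
        * ∑ i : Fin n, wasserstein p eucDist
            (P.map (proj (insert i (par i)))) (Q.map (proj (insert i (par i)))) := by
  have hp0 : 0 < p := one_pos.trans_le hp
  set A : Set ℝ := {r : ℝ | ∃ x y : ∀ i, ↥(Ω i), r = eucDist x y}
  set B : Set ℝ := {r : ℝ | ∃ x y : ∀ i, ↥(Ω i), x ≠ y ∧ r = eucDist x y}
  have hAfin : A.Finite := (Set.finite_range
    fun z : (∀ i, ↥(Ω i)) × (∀ i, ↥(Ω i)) => eucDist z.1 z.2).subset (by
      rintro _ ⟨x, y, rfl⟩
      exact ⟨(x, y), rfl⟩)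
  have hBfin : B.Finite := hAfin.subset (by
    rintro _ ⟨x, y, -, rfl⟩
    exact ⟨x, y, rfl⟩)
  have hle : wasserstein p eucDist P Q ≤ ENNReal.ofReal (sSup A) * tvDist P Q ^ (1 / p) :=
    wasserstein_le_mul_tvDist_rpow hp0 eucDist_self (fun _ _ => Real.sqrt_nonneg _)
      (fun x y => le_csSup hAfin.bddAbove ⟨x, y, rfl⟩) P Q
  rcases subsingleton_or_nontrivial (∀ i, ↥(Ω i)) with _ | _
  · rw [tvDist_eq_zero_of_subsingleton, ENNReal.zero_rpow_of_pos (by positivity), mul_zero] at hle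
    exact hle.trans zero_le
  have hBne : B.Nonempty := by
    obtain ⟨x, y, hxy⟩ := exists_pair_ne (∀ i, ↥(Ω i))
    exact ⟨_, x, y, hxy, rfl⟩
  have hm : 0 < sInf B := by
    obtain ⟨x, y, hxy, h⟩ := hBne.csInf_mem hBfin
    rw [h]
    exact eucDist_pos hxy
  have hmarg (S : Finset (Fin n)) : ENNReal.ofReal (sInf B) *
      tvDist (P.map (proj S)) (Q.map (proj S)) ^ (1 / p) ≤
        wasserstein p eucDist (P.map (proj S)) (Q.map (proj S)) := by
    refine mul_tvDist_rpow_le_wasserstein hp0 hm.le (fun s t hst => ?_) _ _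
    obtain ⟨x, y, hxy, h⟩ := exists_eucDist_eq_of_ne (E := fun i => ↥(Ω i)) S hst
    exact csInf_le hBfin.bddBelow ⟨x, y, hxy, h⟩
  have hconst : ENNReal.ofReal ((2 : ℝ) ^ (1 / p) * sSup A / sInf B) * ENNReal.ofReal (sInf B) =
      ENNReal.ofReal (sSup A) * 2 ^ (1 / p) := by
    rw [← ENNReal.ofReal_mul' hm.le, div_mul_cancel₀ _ hm.ne', ENNReal.ofReal_mul (by positivity),
      ← ENNReal.ofReal_rpow_of_pos two_pos, ENNReal.ofReal_ofNat, mul_comm]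
  calc wasserstein p eucDist P Q
      ≤ ENNReal.ofReal (sSup A) * tvDist P Q ^ (1 / p) := hle
    _ ≤ ENNReal.ofReal (sSup A) * (2 * ∑ i, tvDist (P.map (proj (insert i (par i))))
          (Q.map (proj (insert i (par i))))) ^ (1 / p) := by
        gcongr
        exact hP.tvDist_le hQ hpar
    _ ≤ ENNReal.ofReal (sSup A) * (2 ^ (1 / p) * ∑ i, tvDist (P.map (proj (insert i (par i))))
          (Q.map (proj (insert i (par i)))) ^ (1 / p)) := by
        rw [ENNReal.mul_rpow_of_nonneg _ _ (by positivity)]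
        gcongr
        exact ENNReal.sum_rpow_le_sum_rpow_of_le_one _ _ (by positivity)
          ((div_le_one hp0).2 hp)
    _ = ENNReal.ofReal ((2 : ℝ) ^ (1 / p) * sSup A / sInf B) * ∑ i, ENNReal.ofReal (sInf B) *
          tvDist (P.map (proj (insert i (par i)))) (Q.map (proj (insert i (par i)))) ^ (1 / p) := by
        rw [← Finset.mul_sum, ← mul_assoc, ← mul_assoc, hconst]
    _ ≤ _ := by
        gcongr with i
        exact hmarg _
end
end

section
/- Let V = {1,…,n}, let Ω = ∏_{i∈V} Ω_i with each Ω_i ⊆ ℝ^d, equipped with the Euclidean metric, and let 𝒞 be a finite family of subsets of V. Let P and Q be probability measures on Ω with finite first moments and everywhere-positive densities p and q (with respect to a common σ-finite product reference measure) that factorize as p(x) = ∏_{C∈𝒞} ψ^P_C(x_C) and q(x) = ∏_{C∈𝒞} ψ^Q_C(x_C), where each ψ^P_C, ψ^Q_C is a positive function of the coordinates x_C = (x_i)_{i∈C}. Suppose that for each C ∈ 𝒞 the function log(ψ^P_C/ψ^Q_C) is Lipschitz continuous with Lipschitz constant η_C, and that SKL(P,Q) is finite. Then SKL(P,Q) ≤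 η_max · Σ_{C∈𝒞} W₁(P_{X_C}, Q_{X_C}), where η_max = max_{C∈𝒞} η_C. -/
open MeasureTheory ProbabilityTheory Filter
open scoped ENNReal NNReal

noncomputable section

universe u

open scoped Classical in
/-- The Kullback-Leibler divergence `KL(P,Q) = ∫ log (dP/dQ) dP` when `P ≪ Q` (and the
integral exists), and `+∞` otherwise. -/
def klDiv {Ω : Type*} [MeasurableSpace Ω] (P Q : Measure Ω) : ℝ≥0∞ :=
  if P ≪ Q ∧ Integrable (fun x => Real.log ((P.rnDeriv Q x).toReal)) P
  then ENNReal.ofReal (∫ x, Real.log ((P.rnDeriv Q x).toReal) ∂P)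
  else ⊤

/-- The Symmetric Kullback-Leibler divergence `SKL(P,Q) = KL(P,Q) + KL(Q,P)`. -/
def sklDiv {Ω : Type*} [MeasurableSpace Ω] (P Q : Measure Ω) : ℝ≥0∞ :=
  klDiv P Q + klDiv Q P

section Density

variable {Ω : Type*} [MeasurableSpace Ω]

/-- Chain rule for densities in which the first density need not be measurable. -/
lemma withDensity_mul_of_measurable_right {μ : Measure Ω} [SFinite μ] (f : Ω → ℝ≥0∞)
    {r : Ω → ℝ≥0∞} (hr : Measurable r) (hr0 : ∀ x, r x ≠ 0) (hrt : ∀ x, r x ≠ ⊤) :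
    μ.withDensity (f * r) = (μ.withDensity f).withDensity r := by
  have mono : ∀ {ν₁ ν₂ : Measure Ω} (g : Ω → ℝ≥0∞), ν₁ ≤ ν₂ →
      ν₁.withDensity g ≤ ν₂.withDensity g := fun {ν₁ ν₂} g h ↦ Measure.le_iff.2 fun s hs ↦ by
    rw [withDensity_apply _ hs, withDensity_apply _ hs]
    exact lintegral_mono' (Measure.restrict_mono subset_rfl h) le_rfl
  refine le_antisymm ?_ ?_
  · obtain ⟨k, hk, hkle, hkeq⟩ := exists_measurable_le_withDensity_eq (μ := μ) (f * r)
    have hdiv : (μ.withDensity k).withDensity r⁻¹ ≤ μ.withDensity f := by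
      rw [← withDensity_mul _ hk hr.inv]
      refine withDensity_mono (ae_of_all _ fun x ↦ ?_)
      calc k x * (r x)⁻¹ ≤ f x * r x * (r x)⁻¹ := mul_le_mul_left (hkle x) _
        _ = f x := by rw [mul_assoc, ENNReal.mul_inv_cancel (hr0 x) (hrt x), mul_one]
    have hmul := mono r hdiv
    rw [← withDensity_mul _ hr.inv hr] at hmul
    have hone : r⁻¹ * r = 1 := by
      ext x; exact ENNReal.inv_mul_cancel (hr0 x) (hrt x)
    rwa [hone, withDensity_one, hkeq] at hmul
  · obtain ⟨g, hg, hgle, hgeq⟩ := exists_measurable_le_withDensity_eq (μ := μ) f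
    rw [← hgeq, ← withDensity_mul _ hg hr]
    exact withDensity_mono (ae_of_all _ fun x ↦ mul_le_mul_left (hgle x) _)

lemma log_rnDeriv_ae_eq_of_eq_withDensity_exp {P Q : Measure Ω} [SigmaFinite Q] {L : Ω → ℝ}
    (hL : Measurable L) (h : P = Q.withDensity fun x ↦ ENNReal.ofReal (Real.exp (L x))) :
    (fun x ↦ Real.log (P.rnDeriv Q x).toReal) =ᵐ[P] L := by
  have hac : P ≪ Q := h ▸ withDensity_absolutelyContinuous _ _
  have hrn : P.rnDeriv Q =ᵐ[Q] fun x ↦ ENNReal.ofReal (Real.exp (L x)) := by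
    rw [h]
    exact Measure.rnDeriv_withDensity Q (by fun_prop)
  filter_upwards [hac.ae_le hrn] with x hx
  rw [hx, ENNReal.toReal_ofReal (Real.exp_pos _).le, Real.log_exp]

lemma klDiv_eq_of_eq_withDensity_exp {P Q : Measure Ω} [SigmaFinite Q] {L : Ω → ℝ}
    (hL : Measurable L) (h : P = Q.withDensity fun x ↦ ENNReal.ofReal (Real.exp (L x)))
    (hint : Integrable L P) :
    klDiv P Q = ENNReal.ofReal (∫ x, L x ∂P) := by
  have hlog := log_rnDeriv_ae_eq_of_eq_withDensity_exp hL h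
  have hac : P ≪ Q := h ▸ withDensity_absolutelyContinuous _ _
  rw [klDiv, if_pos ⟨hac, hint.congr hlog.symm⟩, integral_congr_ae hlog]

lemma integral_nonneg_of_eq_withDensity_exp {P Q : Measure Ω} [IsProbabilityMeasure P]
    [IsProbabilityMeasure Q] {L : Ω → ℝ}
    (hL : Measurable L) (h : P = Q.withDensity fun x ↦ ENNReal.ofReal (Real.exp (L x)))
    (hint : Integrable L P) : 0 ≤ ∫ x, L x ∂P := by
  have hlog : llr P Q =ᵐ[P] L := log_rnDeriv_ae_eq_of_eq_withDensity_exp hL h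
  have hac : P ≪ Q := h ▸ withDensity_absolutelyContinuous _ _
  have := InformationTheory.integral_llr_add_sub_measure_univ_nonneg hac (hint.congr hlog.symm)
  simpa [integral_congr_ae hlog] using this

lemma sklDiv_eq_of_eq_withDensity_exp {P Q : Measure Ω} [IsProbabilityMeasure P]
    [IsProbabilityMeasure Q] {L : Ω → ℝ} (hL : Measurable L)
    (h : P = Q.withDensity fun x ↦ ENNReal.ofReal (Real.exp (L x)))
    (hP : Integrable L P) (hQ : Integrable L Q) :
    sklDiv P Q = ENNReal.ofReal (∫ x, L x ∂P - ∫ x, L x ∂Q) := by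
  have h' : Q = P.withDensity fun x ↦ ENNReal.ofReal (Real.exp (-L x)) := by
    rw [h, ← withDensity_mul _ (by fun_prop) (by fun_prop)]
    have hone : ((fun x ↦ ENNReal.ofReal (Real.exp (L x))) *
        fun x ↦ ENNReal.ofReal (Real.exp (-L x))) = 1 := by
      ext x
      simp [← ENNReal.ofReal_mul (Real.exp_pos _).le, ← Real.exp_add]
    rw [hone, withDensity_one]
  rw [sklDiv, klDiv_eq_of_eq_withDensity_exp hL h hP,
    klDiv_eq_of_eq_withDensity_exp hL.neg h' hQ.neg,
    ← ENNReal.ofReal_add (integral_nonneg_of_eq_withDensity_exp hL h hP)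
      (integral_nonneg_of_eq_withDensity_exp hL.neg h' hQ.neg)]
  simp only [Pi.neg_apply, integral_neg, sub_eq_add_neg]

/-- The easy half of Kantorovich–Rubinstein duality. -/
lemma ofReal_integral_sub_le_mul_wasserstein {P Q : Measure Ω} [IsProbabilityMeasure P]
    [IsProbabilityMeasure Q] {c : Ω → Ω → ℝ} {K : ℝ≥0} {u : Ω → ℝ}
    (hP : Integrable u P) (hQ : Integrable u Q) (hu : ∀ x y, |u x - u y| ≤ K * c x y) :
    ENNReal.ofReal (∫ x, u x ∂P - ∫ x, u x ∂Q) ≤ K * wasserstein 1 c P Q := by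
  have : Nonempty (couplings P Q) := ⟨P.prod Q, by simp [couplings]⟩
  simp only [wasserstein, div_one, ENNReal.rpow_one, Real.rpow_one]
  rw [iInf_subtype', ENNReal.mul_iInf' (by simp) (fun _ ↦ inferInstance)]
  refine le_iInf fun ⟨γ, hγ⟩ ↦ ?_
  have hfst : MeasurePreserving Prod.fst γ P := ⟨measurable_fst, hγ.1⟩
  have hsnd : MeasurePreserving Prod.snd γ Q := ⟨measurable_snd, hγ.2⟩
  have h₁ : ∫ x, u x ∂P = ∫ z, u z.1 ∂γ := by
    rw [← hfst.map_eq, integral_map hfst.aemeasurable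
      (hfst.map_eq ▸ hP.aestronglyMeasurable)]
  have h₂ : ∫ x, u x ∂Q = ∫ z, u z.2 ∂γ := by
    rw [← hsnd.map_eq, integral_map hsnd.aemeasurable
      (hsnd.map_eq ▸ hQ.aestronglyMeasurable)]
  have hsub : ∫ z, (u z.1 - u z.2) ∂γ = ∫ z, u z.1 ∂γ - ∫ z, u z.2 ∂γ :=
    integral_sub (hfst.integrable_comp_of_integrable hP) (hsnd.integrable_comp_of_integrable hQ)
  rw [h₁, h₂, ← hsub]
  calc ENNReal.ofReal (∫ z, (u z.1 - u z.2) ∂γ)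
      ≤ ‖∫ z, (u z.1 - u z.2) ∂γ‖ₑ := Real.ofReal_le_enorm _
    _ ≤ ∫⁻ z, ‖u z.1 - u z.2‖ₑ ∂γ := enorm_integral_le_lintegral_enorm _
    _ ≤ ∫⁻ z, K * ENNReal.ofReal (c z.1 z.2) ∂γ := lintegral_mono fun z ↦ by
        rw [Real.enorm_eq_ofReal_abs, ← ENNReal.ofReal_coe_nnreal,
          ← ENNReal.ofReal_mul K.coe_nonneg]
        exact ENNReal.ofReal_le_ofReal (hu _ _)
    _ = K * ∫⁻ z, ENNReal.ofReal (c z.1 z.2) ∂γ := lintegral_const_mul' _ _ (by simp)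

end Density

section EucDist

lemma eucDist_proj_le {n : ℕ} {E : Fin n → Type*} [∀ i, PseudoMetricSpace (E i)]
    (C : Finset (Fin n)) (x y : ∀ i, E i) :
    eucDist (proj C x) (proj C y) ≤ eucDist x y := by
  refine Real.sqrt_le_sqrt ?_
  rw [Finset.univ_eq_attach]
  calc ∑ i ∈ C.attach, dist (proj C x i) (proj C y i) ^ 2
      = ∑ i ∈ C, dist (x i) (y i) ^ 2 := Finset.sum_attach C fun i ↦ dist (x i) (y i) ^ 2
    _ ≤ ∑ i, dist (x i) (y i) ^ 2 :=
        Finset.sum_le_sum_of_subset_of_nonneg (Finset.subset_univ C) fun _ _ _ ↦ sq_nonneg _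

lemma continuous_of_abs_sub_le_mul_eucDist {ι : Type*} [Fintype ι] {E : ι → Type*}
    [∀ i, PseudoMetricSpace (E i)] {u : (∀ i, E i) → ℝ} {K : ℝ}
    (hu : ∀ x y, |u x - u y| ≤ K * eucDist x y) : Continuous u := by
  refine continuous_iff_continuousAt.2 fun y ↦ tendsto_iff_dist_tendsto_zero.2 ?_
  have hcont : Continuous fun x ↦ K * eucDist x y := by unfold eucDist; fun_prop
  have hlim : Tendsto (fun x ↦ K * eucDist x y) (nhds y) (nhds 0) := by
    have := hcont.tendsto y
    rwa [show K * eucDist y y = 0 by simp [eucDist]] at this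
  exact squeeze_zero (fun _ ↦ dist_nonneg) (fun x ↦ hu x y) hlim

end EucDist

/-- Subadditivity of the `1`-Wasserstein distance with respect to the Symmetric KL
divergence on Markov random fields: if `P` and `Q` have everywhere-positive densities
(w.r.t. a common σ-finite product reference measure) factorizing over a family `𝒞` of
cliques, the clique log-ratios `log(ψᴾ_C/ψ^Q_C)` are `η_C`-Lipschitz, `P, Q` have finite
first moments, and `SKL(P,Q)` is finite, then
`SKL(P,Q) ≤ η_max · ∑_{C∈𝒞} W₁(P_{X_C}, Q_{X_C})`. -/
theorem sklDiv_le_max_lipschitz_mul_sum_wasserstein_mrf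
    {d n : ℕ} (S : Fin n → Set (EuclideanSpace ℝ (Fin d)))
    (μ : ∀ i, Measure ↥(S i)) [∀ i, SigmaFinite (μ i)]
    (𝒞 : Finset (Finset (Fin n)))
    (ψP ψQ : (C : Finset (Fin n)) → (∀ j : C, ↥(S j)) → ℝ)
    (hψP : ∀ C ∈ 𝒞, ∀ x, 0 < ψP C x) (hψQ : ∀ C ∈ 𝒞, ∀ x, 0 < ψQ C x)
    (P Q : Measure (∀ i, ↥(S i))) [IsProbabilityMeasure P] [IsProbabilityMeasure Q]
    (hPd : P = (Measure.pi μ).withDensity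
      (fun x => ENNReal.ofReal (∏ C ∈ 𝒞, ψP C (proj C x))))
    (hQd : Q = (Measure.pi μ).withDensity
      (fun x => ENNReal.ofReal (∏ C ∈ 𝒞, ψQ C (proj C x))))
    (hPmom : ∃ x₀, Integrable (fun x => eucDist x x₀) P)
    (hQmom : ∃ x₀, Integrable (fun x => eucDist x x₀) Q)
    (η : Finset (Fin n) → ℝ≥0)
    (hLip : ∀ C ∈ 𝒞, ∀ x y,
      |Real.log (ψP C x / ψQ C x) - Real.log (ψP C y / ψQ C y)| ≤ (η C : ℝ) * eucDist x y)
    (hfin : sklDiv P Q ≠ ⊤) :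
    sklDiv P Q ≤ (𝒞.sup η : ℝ≥0) *
      ∑ C ∈ 𝒞, wasserstein 1 eucDist (P.map (proj C)) (Q.map (proj C)) := by
  set u : (C : Finset (Fin n)) → (∀ j : C, ↥(S j)) → ℝ :=
    fun C x ↦ Real.log (ψP C x / ψQ C x) with hu
  have hu_meas : ∀ C ∈ 𝒞, Measurable (u C) := fun C hC ↦
    (continuous_of_abs_sub_le_mul_eucDist (hLip C hC)).measurable
  have hu_int : ∀ (ν : Measure (∀ i, ↥(S i))) [IsProbabilityMeasure ν],
      (∃ x₀, Integrable (fun x ↦ eucDist x x₀) ν) →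
      ∀ C ∈ 𝒞, Integrable (fun x ↦ u C (proj C x)) ν := by
    rintro ν _ ⟨x₀, hx₀⟩ C hC
    refine ((integrable_const |u C (proj C x₀)|).add (hx₀.const_mul (η C : ℝ))).mono'
      ((hu_meas C hC).comp (measurable_proj C)).aestronglyMeasurable (ae_of_all _ fun x ↦ ?_)
    have h₁ := hLip C hC (proj C x) (proj C x₀)
    have h₂ := mul_le_mul_of_nonneg_left (eucDist_proj_le C x x₀) (η C).coe_nonneg
    have h₃ := abs_sub_abs_le_abs_sub (u C (proj C x)) (u C (proj C x₀))
    simp only [Pi.add_apply, Real.norm_eq_abs]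
    linarith
  have hL : Measurable fun x : ∀ i, ↥(S i) ↦ ∑ C ∈ 𝒞, u C (proj C x) :=
    Finset.measurable_sum _ fun C hC ↦ (hu_meas C hC).comp (measurable_proj C)
  have hPQ : P = Q.withDensity fun x ↦
      ENNReal.ofReal (Real.exp (∑ C ∈ 𝒞, u C (proj C x))) := by
    rw [hPd, hQd, ← withDensity_mul_of_measurable_right _ (by fun_prop)
      (fun x ↦ by simp [Real.exp_pos]) (fun x ↦ ENNReal.ofReal_ne_top)]
    congr 1
    ext x
    have hpos : 0 ≤ ∏ C ∈ 𝒞, ψQ C (proj C x) :=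
      Finset.prod_nonneg fun C hC ↦ (hψQ C hC _).le
    rw [Pi.mul_apply, ← ENNReal.ofReal_mul hpos, Real.exp_sum, ← Finset.prod_mul_distrib]
    congr 1
    refine Finset.prod_congr rfl fun C hC ↦ ?_
    rw [hu, Real.exp_log (div_pos (hψP C hC _) (hψQ C hC _)),
      mul_div_cancel₀ _ (hψQ C hC _).ne']
  have hPint := hu_int P hPmom
  have hQint := hu_int Q hQmom
  rw [sklDiv_eq_of_eq_withDensity_exp hL hPQ (integrable_finsetSum _ hPint)
    (integrable_finsetSum _ hQint), integral_finsetSum _ hPint, integral_finsetSum _ hQint,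
    ← Finset.sum_sub_distrib, Finset.mul_sum]
  refine (Finset.le_sum_of_subadditive ENNReal.ofReal ENNReal.ofReal_zero.le
    (fun _ _ ↦ ENNReal.ofReal_add_le) _ _).trans (Finset.sum_le_sum fun C hC ↦ ?_)
  have hmap : ∀ ν : Measure (∀ i, ↥(S i)),
      ∫ x, u C (proj C x) ∂ν = ∫ y, u C y ∂ν.map (proj C) := fun ν ↦
    (integral_map (measurable_proj C).aemeasurable (hu_meas C hC).aestronglyMeasurable).symm
  have hmap_int : ∀ ν : Measure (∀ i, ↥(S i)), Integrable (fun x ↦ u C (proj C x)) ν →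
      Integrable (u C) (ν.map (proj C)) := fun ν hν ↦
    (integrable_map_measure (hu_meas C hC).aestronglyMeasurable
      (measurable_proj C).aemeasurable).2 hν
  have := Measure.isProbabilityMeasure_map (μ := P) (measurable_proj C).aemeasurable
  have := Measure.isProbabilityMeasure_map (μ := Q) (measurable_proj C).aemeasurable
  rw [hmap P, hmap Q]
  refine (ofReal_integral_sub_le_mul_wasserstein (hmap_int P (hPint C hC))
    (hmap_int Q (hQint C hC)) (hLip C hC)).trans ?_
  gcongr
  exact Finset.le_sup hC
end
end
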